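/- (DG accuracy at interior Gauß–Radau points.) Let f : ℝ × ℝ → ℝ be of class C^{2p+1} and globally Lipschitz in its second argument, let u solve u′(t) = f(t, u(t)), fix t_n, and let −1 < s_0 < ⋯ < s_p = 1 with positive weights ω_i form a quadrature rule on [−1,1] exact for polynomials of degree at most 2p. Then there exist C > 0 and h_0 > 0 such that for every 0 < h ≤ h_0 and every polynomial u_h of degree at most p on I_n = [t_n, t_n + h] satisfying the DG weak formulation with inflow value u(t_n), one has |u(t_{n,m}) − u_h(t_{n,m})| ≤ C h^{p+2} for all 0 ≤ m ≤ p−1, where t_{n,m} = t_n + (h/2)(s_m + 1) are the mapped Gauß–Radau points. -/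

import Mathlib

open Polynomial in
/-- Every coefficient functional on polynomials of degree at most `p` is represented by a test
polynomial through the upwind form on the unit interval. -/
theorem exists_upwind_dual_coeff (p k : ℕ) :
    ∃ V : ℝ[X], V.natDegree ≤ p ∧ ∀ D : ℝ[X], D.natDegree ≤ p →
      -(∫ x in (0:ℝ)..1, D.eval x * (derivative V).eval x) + D.eval 1 * V.eval 1
        = D.coeff k := by
  have hint : ∀ q : ℝ[X], IntervalIntegrable (fun x => q.eval x) MeasureTheory.volume 0 1 :=
    fun q => q.continuous.intervalIntegrable _ _
  let I : ℝ[X] →ₗ[ℝ] ℝ :=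
    { toFun := fun q => ∫ x in (0:ℝ)..1, q.eval x
      map_add' := fun q r => by
        simp only [eval_add]
        exact intervalIntegral.integral_add (hint q) (hint r)
      map_smul' := fun c q => by simp }
  let B : ℝ[X] →ₗ[ℝ] ℝ[X] →ₗ[ℝ] ℝ :=
    LinearMap.mk₂ ℝ (fun V D => -I (D * derivative V) + D.eval 1 * V.eval 1)
      (fun V V' D => by simp [mul_add]; ring) (fun c V D => by simp; ring)
      (fun V D D' => by simp [add_mul]; ring) (fun c V D => by simp; ring)
  have hB : ∀ V D : ℝ[X], B V D = -I (D * derivative V) + D.eval 1 * V.eval 1 := fun _ _ => rfl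
  have hI : ∀ q : ℝ[X], I q = ∫ x in (0:ℝ)..1, q.eval x := fun _ => rfl
  let P := degreeLT ℝ (p + 1)
  have hP : ∀ q : ℝ[X], q ∈ P ↔ q.natDegree ≤ p := fun q => by
    rw [mem_degreeLT, natDegree_le_iff_degree_le, ← Order.lt_succ_iff]
    rfl
  let L : P →ₗ[ℝ] Module.Dual ℝ P := (B.domRestrict₁₂ P P)
  have : FiniteDimensional ℝ P := Module.Finite.of_basis (degreeLT.basis ℝ (p + 1))
  have hinj : Function.Injective L := by
    rw [← LinearMap.ker_eq_bot, LinearMap.ker_eq_bot']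
    rintro ⟨V, hV⟩ h0
    have hz : ∀ D : ℝ[X], D.natDegree ≤ p → B V D = 0 := fun D hD =>
      LinearMap.congr_fun h0 (⟨D, (hP D).2 hD⟩ : P)
    have hVp := (hP V).1 hV
    have hftc : ∫ x in (0:ℝ)..1, (V * derivative V).eval x
        = (V.eval 1) ^ 2 / 2 - (V.eval 0) ^ 2 / 2 := by
      refine intervalIntegral.integral_eq_sub_of_hasDerivAt
        (f := fun x => (V.eval x) ^ 2 / 2) (fun x _ => ?_) (hint _)
      have hd : (V * derivative V).eval x
          = ((2 : ℕ) * V.eval x ^ (2 - 1) * (derivative V).eval x) / 2 := by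
        rw [eval_mul]; push_cast; ring
      rw [hd]
      exact ((V.hasDerivAt x).pow 2).div_const 2
    have h1 := hz V hVp
    rw [hB, hI, hftc] at h1
    have hV1 : V.eval 1 = 0 := by nlinarith [sq_nonneg (V.eval 1), sq_nonneg (V.eval 0)]
    have hV0 : V.eval 0 = 0 := by nlinarith [sq_nonneg (V.eval 1), sq_nonneg (V.eval 0)]
    have h2 := hz (derivative V) ((natDegree_derivative_le V).trans (by omega))
    rw [hB, hI, hV1] at h2
    have h3 : ∫ x in (0:ℝ)..1, (derivative V * derivative V).eval x = 0 := by linarith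
    have h4 : derivative V = 0 := by
      by_contra hne
      obtain ⟨y, hy, hy0⟩ : ∃ y ∈ Set.Icc (0:ℝ) 1, (derivative V).eval y ≠ 0 := by
        by_contra! hall
        exact hne (eq_zero_of_infinite_isRoot _
          ((Set.Icc_infinite (zero_lt_one' ℝ)).mono fun y hy => hall y hy))
      have := intervalIntegral.integral_pos (zero_lt_one' ℝ)
        (derivative V * derivative V).continuous.continuousOn
        (fun x _ => by rw [eval_mul]; exact mul_self_nonneg _)
        ⟨y, hy, by rw [eval_mul]; exact mul_self_pos.2 hy0⟩
      exact this.ne' h3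
    have h5 := eq_C_of_derivative_eq_zero h4
    rw [h5, eval_C] at hV0
    rw [Subtype.ext_iff]
    change V = 0
    rw [h5, hV0, C_0]
  have hsurj : Function.Surjective L :=
    (LinearMap.injective_iff_surjective_of_finrank_eq_finrank
      Subspace.dual_finrank_eq.symm).1 hinj
  obtain ⟨V, hV⟩ := hsurj ((lcoeff ℝ k).domRestrict P)
  refine ⟨V, (hP _).1 V.2, fun D hD => ?_⟩
  have h := LinearMap.congr_fun hV (⟨D, (hP D).2 hD⟩ : P)
  change B V D = D.coeff k at h
  rw [← h, hB, hI]
  simp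

open Polynomial in
/-- The monic nodal polynomial of a right Radau rule, transported to the unit interval, vanishes
at the nodes and is orthogonal to all derivatives of polynomials of degree at most `p`. -/
theorem exists_radau_nodal_polynomial {p : ℕ} (hp : 0 < p) {s ω : Fin (p + 1) → ℝ}
    (hexact : ∀ q : ℝ[X], q.natDegree ≤ 2 * p →
      ∑ i, ω i * q.eval (s i) = ∫ x in (-1:ℝ)..1, q.eval x) :
    ∃ N : ℝ[X], N.Monic ∧ N.natDegree = p + 1 ∧ (∀ i, N.eval ((s i + 1) / 2) = 0) ∧
      ∀ V : ℝ[X], V.natDegree ≤ p →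
        ∫ x in (0:ℝ)..1, N.eval x * (derivative V).eval x = 0 := by
  let N : ℝ[X] := ∏ i, (X - C ((s i + 1) / 2))
  have hdeg : N.natDegree = p + 1 := by
    simp [N, natDegree_prod_of_monic, monic_X_sub_C]
  have hroot : ∀ i, N.eval ((s i + 1) / 2) = 0 := fun i => by
    rw [eval_prod]
    exact Finset.prod_eq_zero (Finset.mem_univ i) (by simp)
  refine ⟨N, monic_prod_of_monic _ _ fun i _ => monic_X_sub_C _, hdeg, hroot, fun V hV => ?_⟩
  have hq : ((N * derivative V).comp (C (1 / 2) * X + C (1 / 2))).natDegree ≤ 2 * p := by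
    refine natDegree_comp_le.trans ?_
    have h1 : (C (1 / 2 : ℝ) * X + C (1 / 2)).natDegree ≤ 1 := natDegree_linear_le
    have h2 : (N * derivative V).natDegree ≤ 2 * p := by
      refine natDegree_mul_le.trans ?_
      have := natDegree_derivative_le V
      omega
    calc _ ≤ 2 * p * 1 := Nat.mul_le_mul h2 h1
      _ = 2 * p := by ring
  have h := hexact _ hq
  rw [Finset.sum_eq_zero fun i _ => ?_] at h
  · simp only [eval_comp, eval_add, eval_mul, eval_C, eval_X] at h
    rw [intervalIntegral.integral_comp_mul_add
      (fun x => N.eval x * (derivative V).eval x) (by norm_num)] at h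
    norm_num at h
    exact h
  · have : (1 / 2 * s i + 1 / 2 : ℝ) = (s i + 1) / 2 := by ring
    simp only [eval_comp, eval_add, eval_mul, eval_C, eval_X, this, hroot, zero_mul, mul_zero]

/-- Solutions of an ordinary differential equation gain one order of smoothness over the
right-hand side. -/
theorem contDiff_of_hasDerivAt_ode {f : ℝ → ℝ → ℝ} {u : ℝ → ℝ} {n : ℕ}
    (hf : ContDiff ℝ n (Function.uncurry f)) (hu : ∀ t, HasDerivAt u (f t (u t)) t) :
    ContDiff ℝ (n + 1) u := by
  have hd : deriv u = fun t => Function.uncurry f (t, u t) := funext fun t => (hu t).deriv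
  have key : ∀ k : ℕ, k ≤ n + 1 → ContDiff ℝ k u := by
    intro k
    induction k with
    | zero =>
      intro _
      exact contDiff_zero.2 (continuous_iff_continuousAt.2 fun t => (hu t).continuousAt)
    | succ k ih =>
      intro hk
      push_cast
      rw [contDiff_succ_iff_deriv]
      refine ⟨fun t => (hu t).differentiableAt, by simp, ?_⟩
      rw [hd]
      exact (hf.of_le (by exact_mod_cast (by omega : k ≤ n))).comp
        (contDiff_id.prodMk (ih (by omega)))
  exact_mod_cast key (n + 1) le_rfl

/-- Taylor's theorem with a remainder bound uniform on a unit interval. -/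
theorem exists_taylor_coeff_bound {u : ℝ → ℝ} {n : ℕ} (hu : ContDiff ℝ (n + 1) u) (a : ℝ) :
    ∃ (c : ℕ → ℝ) (K : ℝ), 0 ≤ K ∧ ∀ y ∈ Set.Icc (0:ℝ) 1,
      |u (a + y) - ∑ k ∈ Finset.range (n + 1), c k * y ^ k| ≤ K * y ^ (n + 1) := by
  obtain ⟨K, hK⟩ := exists_taylor_mean_remainder_bound (f := u) (a := a) (b := a + 1) (n := n)
    (by linarith) hu.contDiffOn
  refine ⟨fun k => (k.factorial : ℝ)⁻¹ * iteratedDerivWithin k u (Set.Icc a (a + 1)) a, |K|,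
    abs_nonneg K, fun y hy => ?_⟩
  have h := hK (a + y) ⟨by linarith [hy.1], by linarith [hy.2]⟩
  rw [taylor_within_apply, Real.norm_eq_abs, add_sub_cancel_left] at h
  refine le_trans (le_of_eq ?_)
    (h.trans (mul_le_mul_of_nonneg_right (le_abs_self K) (pow_nonneg hy.1 _)))
  congr 2
  refine Finset.sum_congr rfl fun k _ => ?_
  simp only [smul_eq_mul]
  ring

open Polynomial in
/-- The DG weak formulation rescaled to the unit interval. -/
theorem dg_formulation_rescaled {p : ℕ} {f : ℝ → ℝ → ℝ} {a h w : ℝ} (hh : 0 < h) {uh : ℝ[X]}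
    (hdg : ∀ v : ℝ[X], v.natDegree ≤ p →
      -(∫ x in a..(a + h), uh.eval x * (derivative v).eval x)
          + uh.eval (a + h) * v.eval (a + h) - w * v.eval a
        = ∫ x in a..(a + h), f x (uh.eval x) * v.eval x)
    {V : ℝ[X]} (hV : V.natDegree ≤ p) :
    -(∫ x in (0:ℝ)..1, uh.eval (h * x + a) * (derivative V).eval x)
        + uh.eval (a + h) * V.eval 1 - w * V.eval 0
      = h * ∫ x in (0:ℝ)..1, f (h * x + a) (uh.eval (h * x + a)) * V.eval x := by
  have hne := hh.ne'
  have hv : (V.comp (C h⁻¹ * X + C (-a / h))).natDegree ≤ p := by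
    refine natDegree_comp_le.trans ?_
    have h1 : (C h⁻¹ * X + C (-a / h)).natDegree ≤ 1 := natDegree_linear_le
    calc _ ≤ p * 1 := Nat.mul_le_mul hV h1
      _ = p := by ring
  have key := hdg _ hv
  have hsc : ∀ g : ℝ → ℝ, ∫ x in a..(a + h), g x = h * ∫ x in (0:ℝ)..1, g (h * x + a) := by
    intro g
    rw [intervalIntegral.integral_comp_mul_add g hne]
    simp [hne, add_comm a h]
  rw [hsc, hsc] at key
  have e1 : ∀ x : ℝ, h⁻¹ * (h * x + a) + -a / h = x := fun x => by field_simp; ring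
  have e2 : h⁻¹ * (a + h) + -a / h = 1 := by field_simp; ring
  have e3 : h⁻¹ * a + -a / h = 0 := by field_simp; ring
  simp only [derivative_comp, eval_comp, eval_mul, eval_add, eval_C, eval_X, e1, e2, e3,
    derivative_add, derivative_mul, derivative_C, derivative_X, zero_mul, mul_one, zero_add,
    add_zero] at key
  rw [← key]
  congr 3
  rw [← intervalIntegral.integral_const_mul]
  refine intervalIntegral.integral_congr fun x _ => ?_
  field_simp

open Polynomial in
/-- Exact solutions satisfy the rescaled DG weak formulation. -/
theorem ode_solution_rescaled_weak {f : ℝ → ℝ → ℝ} (hf : Continuous (Function.uncurry f))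
    {u : ℝ → ℝ} (hu : ∀ t, HasDerivAt u (f t (u t)) t) (a h : ℝ) (V : ℝ[X]) :
    -(∫ x in (0:ℝ)..1, u (h * x + a) * (derivative V).eval x)
        + u (a + h) * V.eval 1 - u a * V.eval 0
      = h * ∫ x in (0:ℝ)..1, f (h * x + a) (u (h * x + a)) * V.eval x := by
  have hc : Continuous u := continuous_iff_continuousAt.2 fun t => (hu t).continuousAt
  have hW : ∀ x, HasDerivAt (fun x => u (h * x + a)) (f (h * x + a) (u (h * x + a)) * h) x :=
    fun x => (hu _).comp x (by simpa using ((hasDerivAt_id x).const_mul h).add_const a)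
  have hfc : Continuous fun x => f (h * x + a) (u (h * x + a)) :=
    hf.comp (by fun_prop : Continuous fun x : ℝ => (h * x + a, u (h * x + a)))
  have := intervalIntegral.integral_mul_deriv_eq_deriv_mul (a := 0) (b := 1)
    (fun x _ => hW x) (fun x _ => V.hasDerivAt x)
    ((hfc.mul continuous_const).intervalIntegrable _ _)
    ((derivative V).continuous.intervalIntegrable _ _)
  rw [this, ← intervalIntegral.integral_const_mul]
  have e : ∀ x, f (h * x + a) (u (h * x + a)) * h * V.eval x
      = h * (f (h * x + a) (u (h * x + a)) * V.eval x) := fun x => by ring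
  simp only [e, mul_one, mul_zero, zero_add, add_comm h a]
  ring

/-- A polynomial is bounded on the unit interval. -/
theorem Polynomial.exists_abs_eval_le_on_unit_interval (q : Polynomial ℝ) :
    ∃ A, ∀ x ∈ Set.Icc (0:ℝ) 1, |q.eval x| ≤ A :=
  isCompact_Icc.exists_bound_of_continuousOn q.continuous.continuousOn

open Polynomial in
/-- Inf-sup stability of the upwind form on polynomials of degree at most `p`. -/
theorem exists_upwind_stability (p : ℕ) :
    ∃ M : ℝ, 0 ≤ M ∧ ∀ (D : ℝ[X]) (β : ℝ), D.natDegree ≤ p →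
      (∀ (V : ℝ[X]) (A : ℝ), V.natDegree ≤ p →
        (∀ x ∈ Set.Icc (0:ℝ) 1, |V.eval x| ≤ A ∧ |(derivative V).eval x| ≤ A) →
        |-(∫ x in (0:ℝ)..1, D.eval x * (derivative V).eval x) + D.eval 1 * V.eval 1| ≤ β * A) →
      ∑ k ∈ Finset.range (p + 1), |D.coeff k| ≤ M * β := by
  choose V hVdeg hV using exists_upwind_dual_coeff p
  choose A hA using fun k => (V k).exists_abs_eval_le_on_unit_interval
  choose A' hA' using fun k => (derivative (V k)).exists_abs_eval_le_on_unit_interval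
  refine ⟨∑ k ∈ Finset.range (p + 1), max (A k) (A' k), Finset.sum_nonneg fun k _ =>
    le_max_of_le_left ((abs_nonneg _).trans (hA k 0 (by simp))), fun D β hD h => ?_⟩
  rw [Finset.sum_mul]
  refine Finset.sum_le_sum fun k _ => ?_
  rw [← hV k D hD, mul_comm _ β]
  exact h _ _ (hVdeg k) fun x hx =>
    ⟨(hA k x hx).trans (le_max_left _ _), (hA' k x hx).trans (le_max_right _ _)⟩

/-- On the unit interval a polynomial is bounded by the sum of its absolute coefficients. -/
theorem Polynomial.abs_eval_le_sum_abs_coeff {p : ℕ} {D : Polynomial ℝ} (hD : D.natDegree ≤ p)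
    {x : ℝ} (hx : x ∈ Set.Icc (0:ℝ) 1) :
    |D.eval x| ≤ ∑ k ∈ Finset.range (p + 1), |D.coeff k| := by
  rw [eval_eq_sum_range' (Nat.lt_succ_of_le hD)]
  refine (Finset.abs_sum_le_sum_abs _ _).trans (Finset.sum_le_sum fun k _ => ?_)
  rw [abs_mul]
  refine mul_le_of_le_one_right (abs_nonneg _) ?_
  rw [abs_of_nonneg (pow_nonneg hx.1 _)]
  exact pow_le_one₀ hx.1 hx.2

open Polynomial in
/-- Perturbed upwind problem: if `E = D + R + γ N` satisfies the DG error equation with a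
Lipschitz right-hand side, `N` being invisible to the form, then the form applied to the
polynomial part `D` is small. -/
theorem abs_upwind_form_le_of_error_equation {D N V : ℝ[X]} {R g : ℝ → ℝ}
    (hR : Continuous R) {h γ r b A : ℝ} (hh : 0 ≤ h)
    (hV : ∀ x ∈ Set.Icc (0:ℝ) 1, |V.eval x| ≤ A ∧ |(derivative V).eval x| ≤ A)
    (hN1 : N.eval 1 = 0) (hN : ∫ x in (0:ℝ)..1, N.eval x * (derivative V).eval x = 0)
    (hRr : ∀ x ∈ Set.Icc (0:ℝ) 1, |R x| ≤ r) (hgb : ∀ x ∈ Set.Icc (0:ℝ) 1, |g x| ≤ b)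
    (herr : -(∫ x in (0:ℝ)..1, (D.eval x + R x + γ * N.eval x) * (derivative V).eval x)
        + (D.eval 1 + R 1 + γ * N.eval 1) * V.eval 1 = h * ∫ x in (0:ℝ)..1, g x * V.eval x) :
    |-(∫ x in (0:ℝ)..1, D.eval x * (derivative V).eval x) + D.eval 1 * V.eval 1|
      ≤ (h * b + 2 * r) * A := by
  have hA : 0 ≤ A := (abs_nonneg _).trans (hV 0 (by simp)).1
  have hr : 0 ≤ r := (abs_nonneg _).trans (hRr 0 (by simp))
  have hb : 0 ≤ b := (abs_nonneg _).trans (hgb 0 (by simp))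
  have hsplit : ∫ x in (0:ℝ)..1, (D.eval x + R x + γ * N.eval x) * (derivative V).eval x
      = (∫ x in (0:ℝ)..1, D.eval x * (derivative V).eval x)
        + (∫ x in (0:ℝ)..1, R x * (derivative V).eval x)
        + γ * ∫ x in (0:ℝ)..1, N.eval x * (derivative V).eval x := by
    rw [← intervalIntegral.integral_const_mul, ← intervalIntegral.integral_add,
      ← intervalIntegral.integral_add]
    · exact intervalIntegral.integral_congr fun x _ => by ring
    all_goals exact Continuous.intervalIntegrable (by fun_prop) _ _
  have hbound : ∀ {F G : ℝ → ℝ} {c : ℝ}, 0 ≤ c → (∀ x ∈ Set.Icc (0:ℝ) 1, |F x| ≤ c) →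
      (∀ x ∈ Set.Icc (0:ℝ) 1, |G x| ≤ A) → |∫ x in (0:ℝ)..1, F x * G x| ≤ c * A := by
    intro F G c hc hF hG
    have := intervalIntegral.norm_integral_le_of_norm_le_const (a := (0:ℝ)) (b := 1)
      (f := fun x => F x * G x) (C := c * A) fun x hx => by
        rw [Set.uIoc_of_le zero_le_one] at hx
        have hx' := Set.Ioc_subset_Icc_self hx
        rw [Real.norm_eq_abs, abs_mul]
        exact mul_le_mul (hF x hx') (hG x hx') (abs_nonneg _) hc
    simpa using this
  have b1 := hbound hb hgb fun x hx => (hV x hx).1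
  have b2 := hbound hr hRr fun x hx => (hV x hx).2
  have b3 : |R 1 * V.eval 1| ≤ r * A := by
    rw [abs_mul]
    exact mul_le_mul (hRr 1 (by simp)) (hV 1 (by simp)).1 (abs_nonneg _) hr
  have b4 : |h * ∫ x in (0:ℝ)..1, g x * V.eval x| ≤ h * (b * A) := by
    rw [abs_mul, abs_of_nonneg hh]
    exact mul_le_mul_of_nonneg_left b1 hh
  rw [hsplit, hN, hN1] at herr
  rw [abs_le] at b2 b3 b4 ⊢
  constructor <;> linarith [b2.1, b2.2, b3.1, b3.2, b4.1, b4.2]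


/-- DG accuracy at the interior Gauß–Radau points. With `f` of class `C^{2p+1}`
and globally Lipschitz in its second argument, `u` solving `u' = f(t, u)`, and a quadrature
rule at nodes `-1 < s 0 < ⋯ < s p = 1` with positive weights exact for degree `2p`,
there exist `C > 0` and `h₀ > 0` such that for all `0 < h ≤ h₀` every DG solution `u_h` of
degree at most `p` on `[t_n, t_n + h]` with inflow `u(t_n)` satisfies
`|u(t_{n,m}) - u_h(t_{n,m})| ≤ C h^{p+2}` for `0 ≤ m ≤ p - 1`, where
`t_{n,m} = t_n + (h/2)(s m + 1)`. -/
theorem dg_accuracy_interior_points (p : ℕ) (f : ℝ → ℝ → ℝ) (Λ : NNReal)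
    (hf : ContDiff ℝ (2 * p + 1) (Function.uncurry f))
    (hLip : ∀ t, LipschitzWith Λ (f t))
    (u : ℝ → ℝ) (hu : ∀ t, HasDerivAt u (f t (u t)) t)
    (tn : ℝ)
    (s ω : Fin (p + 1) → ℝ)
    (hs : StrictMono s) (hs0 : (-1 : ℝ) < s 0) (hsp : s (Fin.last p) = 1)
    (hω : ∀ i, 0 < ω i)
    (hexact : ∀ q : Polynomial ℝ, q.natDegree ≤ 2 * p →
      ∑ i, ω i * q.eval (s i) = ∫ x in (-1:ℝ)..1, q.eval x) :
    ∃ C > 0, ∃ h₀ > 0, ∀ h : ℝ, 0 < h → h ≤ h₀ →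
      ∀ uh : Polynomial ℝ, uh.natDegree ≤ p →
        (∀ v : Polynomial ℝ, v.natDegree ≤ p →
          -(∫ x in tn..(tn + h), uh.eval x * (Polynomial.derivative v).eval x)
              + uh.eval (tn + h) * v.eval (tn + h) - u tn * v.eval tn
            = ∫ x in tn..(tn + h), f x (uh.eval x) * v.eval x) →
        ∀ m : Fin (p + 1), (m : ℕ) < p →
          |u (tn + h / 2 * (s m + 1)) - uh.eval (tn + h / 2 * (s m + 1))|
            ≤ C * h ^ (p + 2) := by
  rcases Nat.eq_zero_or_pos p with rfl | hp
  · exact ⟨1, one_pos, 1, one_pos, fun _ _ _ _ _ _ m hm => absurd hm (Nat.not_lt_zero _)⟩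
  have hu1 : ContDiff ℝ ((2 * p + 1 : ℕ) + 1) u :=
    contDiff_of_hasDerivAt_ode (by exact_mod_cast hf) hu
  have hu2 : ContDiff ℝ ((p + 1 : ℕ) + 1) u :=
    hu1.of_le (by exact_mod_cast (by omega : p + 1 + 1 ≤ 2 * p + 1 + 1))
  obtain ⟨c, K, hK, hT⟩ := exists_taylor_coeff_bound hu2 tn
  obtain ⟨N, hNm, hNd, hNroot, hNorth⟩ := exists_radau_nodal_polynomial hp hexact
  obtain ⟨B, hB⟩ := N.exists_abs_eval_le_on_unit_interval
  obtain ⟨M, hM, hstab⟩ := exists_upwind_stability p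
  have hB0 : 0 ≤ B := (abs_nonneg _).trans (hB 0 (by simp))
  have hN1 : N.eval 1 = 0 := by simpa [hsp] using hNroot (Fin.last p)
  have hucont : Continuous u := hu2.continuous
  have hfcont : Continuous (Function.uncurry f) := hf.continuous
  have hΛ : (0:ℝ) ≤ Λ := Λ.2
  set G : ℝ := K + |c (p + 1)| * B with hG
  have hG0 : 0 ≤ G := by positivity
  refine ⟨2 * M * (Λ * G + 2 * K) + K + 1, by positivity, min 1 (1 / (2 * (M * Λ + 1))),
    by positivity, fun h hh hle uh huh hdg m _ => ?_⟩
  have hh1 : h ≤ 1 := hle.trans (min_le_left _ _)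
  have hsmall : h * (M * Λ) ≤ 1 / 2 := by
    have h2 := hle.trans (min_le_right _ _)
    rw [le_div_iff₀ (by positivity)] at h2
    nlinarith
  set γ : ℝ := c (p + 1) * h ^ (p + 1) with hγ
  set Uh : Polynomial ℝ := uh.comp (Polynomial.C h * Polynomial.X + Polynomial.C tn) with hUh
  set D : Polynomial ℝ := ∑ k ∈ Finset.range (p + 1),
    Polynomial.C (c k * h ^ k) * Polynomial.X ^ k
      + Polynomial.C γ * (Polynomial.X ^ (p + 1) - N) - Uh with hDdef
  have hUheval : ∀ x, Uh.eval x = uh.eval (h * x + tn) := fun x => by simp [hUh]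
  have hDdeg : D.natDegree ≤ p := by
    refine (Polynomial.natDegree_sub_le_of_le (n := p) (Polynomial.natDegree_add_le_of_degree_le
      (Polynomial.natDegree_sum_le_of_forall_le _ _ fun k hk => ?_) ?_) ?_).trans (max_self p).le
    · exact (Polynomial.natDegree_C_mul_X_pow_le _ _).trans
        (Nat.lt_succ_iff.1 (Finset.mem_range.1 hk))
    · refine (Polynomial.natDegree_C_mul_le _ _).trans ?_
      have hlt := Polynomial.degree_sub_lt_left (p := Polynomial.X ^ (p + 1)) (q := N)
        (by rw [Polynomial.degree_X_pow, Polynomial.degree_eq_natDegree hNm.ne_zero, hNd])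
        (Polynomial.monic_X_pow _).ne_zero (by rw [Polynomial.leadingCoeff_X_pow, hNm])
      rw [Polynomial.degree_X_pow] at hlt
      rw [Polynomial.natDegree_le_iff_degree_le]
      exact Order.le_of_lt_succ hlt
    · refine Polynomial.natDegree_comp_le.trans ?_
      calc _ ≤ p * 1 := Nat.mul_le_mul huh Polynomial.natDegree_linear_le
        _ = p := mul_one p
  let R : ℝ → ℝ := fun x => u (h * x + tn) - Uh.eval x - D.eval x - γ * N.eval x
  have hRcont : Continuous R := by fun_prop
  have hsplit : ∀ x, u (h * x + tn) - uh.eval (h * x + tn) = D.eval x + R x + γ * N.eval x :=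
    fun x => by simp only [R, hUheval]; ring
  have hRr : ∀ x ∈ Set.Icc (0:ℝ) 1, |R x| ≤ K * h ^ (p + 2) := by
    intro x hx
    have hhx : h * x ∈ Set.Icc (0:ℝ) 1 :=
      ⟨mul_nonneg hh.le hx.1, mul_le_one₀ hh1 hx.1 hx.2⟩
    have hRx : R x = u (tn + h * x) - ∑ k ∈ Finset.range (p + 1 + 1), c k * (h * x) ^ k := by
      rw [Finset.sum_range_succ]
      simp only [R, hDdef, hγ, Polynomial.eval_sub, Polynomial.eval_add,
        Polynomial.eval_finsetSum, Polynomial.eval_mul, Polynomial.eval_C,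
        Polynomial.eval_pow, Polynomial.eval_X, mul_pow, mul_assoc, add_comm tn]
      ring
    rw [hRx]
    refine (hT _ hhx).trans (mul_le_mul_of_nonneg_left ?_ hK)
    exact pow_le_pow_left₀ hhx.1 (mul_le_of_le_one_right hh.le hx.2) _
  set S := ∑ k ∈ Finset.range (p + 1), |D.coeff k| with hS
  have hDS : ∀ x ∈ Set.Icc (0:ℝ) 1, |D.eval x| ≤ S := fun x hx =>
    Polynomial.abs_eval_le_sum_abs_coeff hDdeg hx
  let g : ℝ → ℝ := fun x => f (h * x + tn) (u (h * x + tn)) - f (h * x + tn) (uh.eval (h * x + tn))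
  have hfu : Continuous fun x => f (h * x + tn) (u (h * x + tn)) :=
    hfcont.comp (by fun_prop : Continuous fun x : ℝ => (h * x + tn, u (h * x + tn)))
  have hfuh : Continuous fun x => f (h * x + tn) (uh.eval (h * x + tn)) :=
    hfcont.comp (by fun_prop : Continuous fun x : ℝ => (h * x + tn, uh.eval (h * x + tn)))
  have hpow : h ^ (p + 2) ≤ h ^ (p + 1) := pow_le_pow_of_le_one hh.le hh1 (by omega)
  have hgb : ∀ x ∈ Set.Icc (0:ℝ) 1, |g x| ≤ Λ * (S + G * h ^ (p + 1)) := by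
    intro x hx
    have h1 := (hLip (h * x + tn)).dist_le_mul (u (h * x + tn)) (uh.eval (h * x + tn))
    rw [Real.dist_eq, Real.dist_eq, hsplit] at h1
    refine h1.trans (mul_le_mul_of_nonneg_left ?_ hΛ)
    have h2 : |γ * N.eval x| ≤ |c (p + 1)| * h ^ (p + 1) * B := by
      rw [abs_mul, hγ, abs_mul, abs_of_pos (pow_pos hh _)]
      exact mul_le_mul_of_nonneg_left (hB x hx) (by positivity)
    have h3 := mul_le_mul_of_nonneg_left hpow hK
    have h4 := abs_add_three (D.eval x) (R x) (γ * N.eval x)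
    rw [hG]
    linarith [hDS x hx, hRr x hx]
  have hSle : S ≤ M * (h * (Λ * (S + G * h ^ (p + 1))) + 2 * (K * h ^ (p + 2))) := by
    refine hstab D _ hDdeg fun V A hVdeg hV => ?_
    refine abs_upwind_form_le_of_error_equation hRcont hh.le hV hN1
      (hNorth V hVdeg) hRr hgb (γ := γ) ?_
    have e1 := ode_solution_rescaled_weak hfcont hu tn h V
    have e2 := dg_formulation_rescaled hh hdg hVdeg
    have i1 : ∫ x in (0:ℝ)..1, (D.eval x + R x + γ * N.eval x) * (Polynomial.derivative V).eval x
        = (∫ x in (0:ℝ)..1, u (h * x + tn) * (Polynomial.derivative V).eval x)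
          - ∫ x in (0:ℝ)..1, uh.eval (h * x + tn) * (Polynomial.derivative V).eval x := by
      rw [← intervalIntegral.integral_sub]
      · exact intervalIntegral.integral_congr fun x _ => by simp only [← hsplit]; ring
      all_goals exact Continuous.intervalIntegrable (by fun_prop) _ _
    have i2 : ∫ x in (0:ℝ)..1, g x * V.eval x
        = (∫ x in (0:ℝ)..1, f (h * x + tn) (u (h * x + tn)) * V.eval x)
          - ∫ x in (0:ℝ)..1, f (h * x + tn) (uh.eval (h * x + tn)) * V.eval x := by
      rw [← intervalIntegral.integral_sub]
      · exact intervalIntegral.integral_congr fun x _ => by simp only [g]; ring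
      · exact (hfu.mul V.continuous).intervalIntegrable _ _
      · exact (hfuh.mul V.continuous).intervalIntegrable _ _
    have e3 := hsplit 1
    rw [mul_one, add_comm h tn] at e3
    change _ = h * ∫ x in (0:ℝ)..1, g x * V.eval x
    rw [i1, i2, ← e3, mul_sub, ← e1, ← e2]
    ring
  have hSfin : S ≤ 2 * M * (Λ * G + 2 * K) * h ^ (p + 2) := by
    have hS0 : 0 ≤ S := Finset.sum_nonneg fun _ _ => abs_nonneg _
    have h1 := mul_le_mul_of_nonneg_right hsmall hS0
    have h2 : h ^ (p + 2) = h * h ^ (p + 1) := by ring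
    rw [h2] at hSle ⊢
    linarith
  have hxm : (s m + 1) / 2 ∈ Set.Icc (0:ℝ) 1 := by
    have h1 : s 0 ≤ s m := hs.monotone (Fin.zero_le m)
    have h2 : s m ≤ s (Fin.last p) := hs.monotone (Fin.le_last m)
    constructor <;> linarith
  have ht : tn + h / 2 * (s m + 1) = h * ((s m + 1) / 2) + tn := by ring
  rw [ht, hsplit, hNroot, mul_zero, add_zero]
  have hpos := pow_pos hh (p + 2)
  linarith [abs_add_le (D.eval ((s m + 1) / 2)) (R ((s m + 1) / 2)), hDS _ hxm, hRr _ hxm]
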